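/- arXiv:1312.7328 — 5 statements merged into one kernel-verified Lean document; each statement's English description precedes it below -/
import Mathlib

section
/- Let k ∈ ℝ and let ξ = ξ_r + i ξ_i ∈ ℂ with ξ_r ∈ ℝ and ξ_i < −1. Then the generalized Fourier transform of the call payoff h(x) = (e^x − e^k)^+ converges absolutely and equals (1/√(2π)) ∫_ℝ e^{-iξx} (e^x − e^k)^+ dx = − e^{k − i k ξ} / ( √(2π) (iξ + ξ²) ). -/
open MeasureTheory Real Complex

/-- the generalized Fourier transform of the call payoff
`h(x) = (e^x − e^k)⁺` at a complex argument `ξ` with `Im ξ < −1` converges absolutely and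
equals `−e^{k − ikξ}/(√(2π)(iξ + ξ²))`. -/
theorem stmt8 (k : ℝ) (ξ : ℂ) (hξ : ξ.im < -1) :
    Integrable (fun x : ℝ =>
      Complex.exp (-(Complex.I * ξ * (x : ℂ))) *
        ((max (Real.exp x - Real.exp k) 0 : ℝ) : ℂ)) volume ∧
    ((Real.sqrt (2 * Real.pi) : ℂ))⁻¹ *
        ∫ x : ℝ, Complex.exp (-(Complex.I * ξ * (x : ℂ))) *
          ((max (Real.exp x - Real.exp k) 0 : ℝ) : ℂ) =
      -Complex.exp ((k : ℂ) - Complex.I * (k : ℂ) * ξ) /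
        ((Real.sqrt (2 * Real.pi) : ℂ) * (Complex.I * ξ + ξ ^ 2)) := by
  have ha : (1 - Complex.I * ξ).re < 0 := by
    simp; linarith
  have hb : (-(Complex.I * ξ)).re < 0 := by
    simp; linarith
  have ha0 : (1 - Complex.I * ξ) ≠ 0 := by
    intro h; rw [h] at ha; simp at ha
  have hb0 : (-(Complex.I * ξ)) ≠ 0 := by
    intro h; rw [h] at hb; simp at hb
  have hfun : (fun x : ℝ =>
      Complex.exp (-(Complex.I * ξ * (x : ℂ))) *
        ((max (Real.exp x - Real.exp k) 0 : ℝ) : ℂ)) =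
      (Set.Ioi k).indicator (fun x : ℝ => Complex.exp ((1 - Complex.I * ξ) * x) -
        Complex.exp k * Complex.exp (-(Complex.I * ξ) * x)) := by
    funext x
    by_cases hx : k < x
    · rw [Set.indicator_of_mem (Set.mem_Ioi.mpr hx),
        max_eq_left (sub_nonneg.mpr (Real.exp_le_exp.mpr hx.le))]
      have h1 : (1 - Complex.I * ξ) * x = -(Complex.I * ξ * x) + x := by ring
      rw [h1, Complex.exp_add, neg_mul]
      push_cast
      ring
    · rw [Set.indicator_of_notMem (by simpa using hx),
        max_eq_right (sub_nonpos.mpr (Real.exp_le_exp.mpr (not_lt.mp hx)))]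
      simp
  have i1 := integrableOn_exp_mul_complex_Ioi ha k
  have i2 := (integrableOn_exp_mul_complex_Ioi hb k).const_mul (Complex.exp k)
  rw [hfun]
  refine ⟨(i1.sub i2).integrable_indicator measurableSet_Ioi, ?_⟩
  rw [integral_indicator measurableSet_Ioi, integral_sub i1 i2, integral_const_mul,
    integral_exp_mul_complex_Ioi ha, integral_exp_mul_complex_Ioi hb]
  have e1 : (1 - Complex.I * ξ) * k = k - Complex.I * k * ξ := by ring
  have e2 : Complex.exp k * (-Complex.exp (-(Complex.I * ξ) * k) / (-(Complex.I * ξ)))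
      = -Complex.exp (k - Complex.I * k * ξ) / (-(Complex.I * ξ)) := by
    have : (k : ℂ) - Complex.I * k * ξ = k + -(Complex.I * ξ) * k := by ring
    rw [this, Complex.exp_add]; ring
  have e3 : Complex.I * ξ + ξ ^ 2 = -((1 - Complex.I * ξ) * (-(Complex.I * ξ))) := by
    linear_combination (ξ ^ 2) * Complex.I_sq
  have hs : (Real.sqrt (2 * Real.pi) : ℂ) ≠ 0 := by
    exact_mod_cast (Real.sqrt_pos.mpr (by positivity)).ne'
  rw [e1, e2, e3]
  generalize Complex.exp (k - Complex.I * k * ξ) = E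
  have hab : (1 - Complex.I * ξ) = 1 + (-(Complex.I * ξ)) := by ring
  rw [hab] at ha0 ⊢
  generalize -(Complex.I * ξ) = b at *
  field_simp
  ring
end

section
/- Fix M̄ > 0. For t < T and x, y ∈ ℝ define Γ̄(t,x;T,y) := e^{−M̄(T−t)} Σ_{n=0}^∞ (M̄(T−t))^n / ( n! √(2π M̄ (T−t+n)) ) · exp( −(x − y + M̄ n)² / (2 M̄ (T−t+n)) ), and let 𝒞 be the operator 𝒞f(x) := ∫_ℝ f(x+z) 𝒩_{M̄,M̄}(dz) acting in the x-variable, where 𝒩_{M̄,M̄} is the Gaussian measure with mean M̄ and variance M̄. Then for all integers k, N ≥ 0 and all t < s < T and x, y ∈ ℝ, the Chapman–Kolmogorov (semigroup) identity holds: ∫_ℝ 𝒞^k Γ̄(t,x;s,ξ) · 𝒞^N Γ̄(s,ξ;T,y) dξ = 𝒞^{k+N} Γ̄(t,x;T,y). -/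
open MeasureTheory ProbabilityTheory Real

/-- The fundamental solution `Γ̄(t,x;T,y)` of the constant-coefficient jump-diffusion
operator with parameter `M̄`. -/
noncomputable def Gbar (M t T x y : ℝ) : ℝ :=
  Real.exp (-(M * (T - t))) * ∑' n : ℕ,
    (M * (T - t)) ^ n / ((n.factorial : ℝ) * Real.sqrt (2 * Real.pi * M * (T - t + n))) *
      Real.exp (-(x - y + M * n) ^ 2 / (2 * M * (T - t + n)))

/-- The convolution operator `𝒞 f(x) = ∫ f(x+z) 𝒩_{M̄,M̄}(dz)`. -/
noncomputable def Cop (M : ℝ) (f : ℝ → ℝ) : ℝ → ℝ :=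
  fun x => ∫ z, f (x + z) ∂(gaussianReal M M.toNNReal)


/-- centered Gaussian density of variance `q` -/
noncomputable def gk (q a : ℝ) : ℝ := (Real.sqrt (2 * π * q))⁻¹ * Real.exp (-a ^ 2 / (2 * q))

lemma gk_nonneg (q a : ℝ) : 0 ≤ gk q a := by unfold gk; positivity

lemma gk_neg (q a : ℝ) : gk q (-a) = gk q a := by unfold gk; rw [neg_sq]

lemma gk_le {q₀ q : ℝ} (h0 : 0 < q₀) (h : q₀ ≤ q) (a : ℝ) : gk q a ≤ (Real.sqrt (2 * π * q₀))⁻¹ := by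
  unfold gk
  have h1 : Real.exp (-a ^ 2 / (2 * q)) ≤ 1 := by
    rw [Real.exp_le_one_iff]
    apply div_nonpos_of_nonpos_of_nonneg
    · nlinarith [sq_nonneg a]
    · linarith
  have h2 : (Real.sqrt (2 * π * q))⁻¹ ≤ (Real.sqrt (2 * π * q₀))⁻¹ := by
    have := Real.pi_pos
    apply inv_anti₀ (by positivity)
    apply Real.sqrt_le_sqrt
    nlinarith
  calc _ ≤ (Real.sqrt (2 * π * q))⁻¹ * 1 := by gcongr
    _ ≤ _ := by rw [mul_one]; exact h2

lemma gk_eq (q m a : ℝ) (hq : 0 ≤ q) : gaussianPDFReal m q.toNNReal a = gk q (a - m) := by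
  simp [gaussianPDFReal, gk, Real.coe_toNNReal q hq]

lemma gk_mul {u v : ℝ} (hu : 0 < u) (hv : 0 < v) (a b ξ : ℝ) :
    gk u (a - ξ) * gk v (ξ - b) =
      gk (u + v) (a - b) * gaussianPDFReal ((v * a + u * b) / (u + v)) (u * v / (u + v)).toNNReal ξ := by
  have huv : 0 < u + v := by positivity
  rw [gk_eq _ _ _ (by positivity)]
  unfold gk
  have hs : (Real.sqrt (2 * π * u))⁻¹ * (Real.sqrt (2 * π * v))⁻¹ =
      (Real.sqrt (2 * π * (u + v)))⁻¹ * (Real.sqrt (2 * π * (u * v / (u + v))))⁻¹ := by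
    rw [← mul_inv, ← mul_inv, ← Real.sqrt_mul (by positivity), ← Real.sqrt_mul (by positivity)]
    congr 2
    field_simp
  rw [mul_mul_mul_comm, hs, mul_mul_mul_comm (√(2 * π * (u + v)))⁻¹ (rexp (-(a - b) ^ 2 / (2 * (u + v)))), ← Real.exp_add, ← Real.exp_add]
  congr 2
  field_simp
  ring

lemma gk_conv_integrable {u v : ℝ} (hu : 0 < u) (hv : 0 < v) (a b : ℝ) :
    Integrable (fun ξ => gk u (a - ξ) * gk v (ξ - b)) := by
  simp_rw [gk_mul hu hv]
  exact (integrable_gaussianPDFReal _ _).const_mul _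

lemma gk_conv {u v : ℝ} (hu : 0 < u) (hv : 0 < v) (a b : ℝ) :
    ∫ ξ, gk u (a - ξ) * gk v (ξ - b) = gk (u + v) (a - b) := by
  simp_rw [gk_mul hu hv]
  rw [integral_const_mul, integral_gaussianPDFReal_eq_one, mul_one]
  have : 0 < u * v / (u + v) := by positivity
  simpa using this

/-- Exchange of series and convolution integral. -/
lemma conv_tsum {ι : Type*} [Countable ι] (w u v a b : ι → ℝ) (q₀ : ℝ) (h0 : 0 < q₀)
    (hw : ∀ i, 0 ≤ w i) (hs : Summable w) (hu : ∀ i, 0 < u i) (hv : ∀ i, 0 < v i)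
    (hq : ∀ i, q₀ ≤ u i + v i) :
    (∫ ξ, ∑' i, w i * (gk (u i) (a i - ξ) * gk (v i) (ξ - b i))) =
      ∑' i, w i * gk (u i + v i) (a i - b i) := by
  have hI : ∀ i, ∫ ξ, w i * (gk (u i) (a i - ξ) * gk (v i) (ξ - b i)) =
      w i * gk (u i + v i) (a i - b i) := fun i => by
    rw [integral_const_mul, gk_conv (hu i) (hv i)]
  have := hasSum_integral_of_summable_integral_norm (μ := volume)
    (F := fun i ξ => w i * (gk (u i) (a i - ξ) * gk (v i) (ξ - b i)))
    (fun i => (gk_conv_integrable (hu i) (hv i) _ _).const_mul _) (by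
      have e : ∀ i ξ, ‖w i * (gk (u i) (a i - ξ) * gk (v i) (ξ - b i))‖ =
          w i * (gk (u i) (a i - ξ) * gk (v i) (ξ - b i)) := fun i ξ =>
        Real.norm_of_nonneg (mul_nonneg (hw i) (mul_nonneg (gk_nonneg _ _) (gk_nonneg _ _)))
      simp_rw [e, hI]
      refine Summable.of_nonneg_of_le (fun i => mul_nonneg (hw i) (gk_nonneg _ _))
        (fun i => mul_le_mul_of_nonneg_left (gk_le h0 (hq i) _) (hw i)) (hs.mul_right _))
  simp_rw [hI] at this
  exact this.tsum_eq.symm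

/-- Closed form of the iterates. -/
noncomputable def Hk (M : ℝ) (k : ℕ) (τ a : ℝ) : ℝ :=
  Real.exp (-(M * τ)) * ∑' n : ℕ, (M * τ) ^ n / (n.factorial : ℝ) *
    gk (M * (τ + n + k)) (a + M * (n + k))

lemma Gbar_eq (M t T x y : ℝ) : Gbar M t T x y = Hk M 0 (T - t) (x - y) := by
  unfold Gbar Hk gk
  congr 1
  refine tsum_congr fun n => ?_
  simp only [Nat.cast_zero, add_zero]
  rw [← mul_assoc, div_mul_eq_div_div, ← div_eq_mul_inv, ← mul_assoc (2 * π), ← mul_assoc 2 M]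

lemma Cop_Hk (M : ℝ) (hM : 0 < M) (k : ℕ) (τ y : ℝ) (hτ : 0 < τ) :
    Cop M (fun x => Hk M k τ (x - y)) = fun x => Hk M (k + 1) τ (x - y) := by
  funext x
  unfold Cop
  rw [integral_gaussianReal_eq_integral_smul (by simpa using hM)]
  unfold Hk
  have e : ∀ z : ℝ, gaussianPDFReal M M.toNNReal z • (Real.exp (-(M * τ)) *
      ∑' n : ℕ, (M * τ) ^ n / (n.factorial : ℝ) *
        gk (M * (τ + n + k)) (x + z - y + M * (n + k))) =
      Real.exp (-(M * τ)) * ∑' n : ℕ, (M * τ) ^ n / (n.factorial : ℝ) *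
        (gk M (M - z) * gk (M * (τ + n + k)) (z - -(x - y + M * (n + k)))) := by
    intro z
    rw [gk_eq _ _ _ hM.le, ← gk_neg, neg_sub, smul_eq_mul, mul_left_comm, ← tsum_mul_left]
    congr 1
    refine tsum_congr fun n => ?_
    rw [mul_left_comm]
    congr 3
    ring
  simp_rw [e]
  rw [integral_const_mul]
  rw [conv_tsum (fun n : ℕ => (M * τ) ^ n / (n.factorial : ℝ)) (fun _ => M)
    (fun n => M * (τ + n + k)) (fun _ => M) (fun n : ℕ => -(x - y + M * (n + k))) M hM
    (fun n => by positivity) (Real.summable_pow_div_factorial _) (fun _ => hM)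
    (fun n => by positivity) (fun n => by
      have : 0 < M * (τ + n + k) := by positivity
      linarith)]
  congr 1
  refine tsum_congr fun n => ?_
  push_cast
  congr 2 <;> ring

lemma Cop_iter (M : ℝ) (hM : 0 < M) (k : ℕ) (t T y : ℝ) (h : t < T) :
    (Cop M)^[k] (fun x => Gbar M t T x y) = fun x => Hk M k (T - t) (x - y) := by
  induction k with
  | zero => funext x; simp [Gbar_eq]
  | succ k ih => rw [Function.iterate_succ_apply', ih, Cop_Hk M hM k _ y (by linarith)]

lemma summ_Hk (M : ℝ) (hM : 0 < M) (k : ℕ) (τ a : ℝ) (hτ : 0 < τ) :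
    Summable fun n : ℕ => (M * τ) ^ n / (n.factorial : ℝ) *
      gk (M * (τ + n + k)) (a + M * (n + k)) := by
  refine Summable.of_nonneg_of_le (fun n => mul_nonneg (by positivity) (gk_nonneg _ _))
    (fun n => mul_le_mul_of_nonneg_left
      (gk_le (q₀ := M * τ) (by positivity) ?_ _) (by positivity))
      ((Real.summable_pow_div_factorial (M * τ)).mul_right _)
  gcongr
  have : (0 : ℝ) ≤ n := by positivity
  have : (0 : ℝ) ≤ k := by positivity
  linarith

lemma binom_sum (p q : ℝ) (n : ℕ) :
    ∑ x ∈ Finset.HasAntidiagonal.antidiagonal n, p ^ x.1 / (x.1.factorial : ℝ) * (q ^ x.2 / (x.2.factorial : ℝ)) =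
      (p + q) ^ n / (n.factorial : ℝ) := by
  rw [(Commute.all p q).add_pow', Finset.sum_div]
  refine Finset.sum_congr rfl fun x hx => ?_
  rw [Finset.HasAntidiagonal.mem_antidiagonal] at hx
  subst hx
  rw [nsmul_eq_mul, Nat.cast_add_choose]
  field_simp

theorem Hk_semigroup (M : ℝ) (hM : 0 < M) (k N : ℕ) (τ σ x y : ℝ) (hτ : 0 < τ) (hσ : 0 < σ) :
    ∫ ξ : ℝ, Hk M k τ (x - ξ) * Hk M N σ (ξ - y) = Hk M (k + N) (τ + σ) (x - y) := by
  have e : ∀ ξ : ℝ, Hk M k τ (x - ξ) * Hk M N σ (ξ - y) =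
      Real.exp (-(M * (τ + σ))) * ∑' i : ℕ × ℕ,
        ((M * τ) ^ i.1 / (i.1.factorial : ℝ) * ((M * σ) ^ i.2 / (i.2.factorial : ℝ))) *
        (gk (M * (τ + i.1 + k)) ((x + M * (i.1 + k)) - ξ) *
          gk (M * (σ + i.2 + N)) (ξ - (y - M * (i.2 + N)))) := by
    intro ξ
    unfold Hk
    rw [mul_mul_mul_comm, ← Real.exp_add,
      tsum_mul_tsum_of_summable_norm (summ_Hk M hM k τ _ hτ).norm (summ_Hk M hM N σ _ hσ).norm]
    congr 2
    · ring
    · funext i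
      rw [mul_mul_mul_comm]
      congr 3 <;> ring
  simp_rw [e]
  rw [integral_const_mul]
  have hws : Summable (fun i : ℕ × ℕ =>
      (M * τ) ^ i.1 / (i.1.factorial : ℝ) * ((M * σ) ^ i.2 / (i.2.factorial : ℝ))) :=
    (Real.summable_pow_div_factorial (M * τ)).mul_of_nonneg
      (Real.summable_pow_div_factorial (M * σ)) (fun n => by positivity) (fun n => by positivity)
  have hle : ∀ i : ℕ × ℕ, M * τ ≤ M * (τ + i.1 + k) + M * (σ + i.2 + N) := fun i => by
    have : 0 ≤ M * (i.1 + k : ℝ) + M * (σ + i.2 + N) := by positivity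
    nlinarith
  rw [conv_tsum (fun i : ℕ × ℕ =>
      (M * τ) ^ i.1 / (i.1.factorial : ℝ) * ((M * σ) ^ i.2 / (i.2.factorial : ℝ)))
    (fun i => M * (τ + i.1 + k)) (fun i => M * (σ + i.2 + N)) (fun i => x + M * (i.1 + k))
    (fun i => y - M * (i.2 + N)) (M * τ) (by positivity) (fun i => by positivity) hws
    (fun i => by positivity) (fun i => by positivity) hle]
  unfold Hk
  congr 1
  have hsum : Summable (fun i : ℕ × ℕ =>
      ((M * τ) ^ i.1 / (i.1.factorial : ℝ) * ((M * σ) ^ i.2 / (i.2.factorial : ℝ))) *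
      gk (M * (τ + i.1 + k) + M * (σ + i.2 + N)) (x + M * (i.1 + k) - (y - M * (i.2 + N)))) :=
    Summable.of_nonneg_of_le (fun i => mul_nonneg (by positivity) (gk_nonneg _ _))
      (fun i => mul_le_mul_of_nonneg_left (gk_le (q₀ := M * τ) (by positivity) (hle i) _)
        (by positivity)) (hws.mul_right _)
  rw [← Finset.HasAntidiagonal.sigmaAntidiagonalEquivProd.tsum_eq,
    Summable.tsum_sigma' (fun n => (hasSum_fintype _).summable)
      (by
        have := Finset.HasAntidiagonal.sigmaAntidiagonalEquivProd.summable_iff.2 hsum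
        simpa only [Function.comp_def] using this)]
  refine tsum_congr fun n => ?_
  rw [mul_add, ← binom_sum, Finset.sum_mul, tsum_fintype, 
    ← Finset.sum_coe_sort (Finset.HasAntidiagonal.antidiagonal n)]
  refine Finset.sum_congr rfl fun i _ => ?_
  have hi : ((i : ℕ × ℕ).1 : ℝ) + (i : ℕ × ℕ).2 = n := by
    exact_mod_cast Finset.HasAntidiagonal.mem_antidiagonal.1 i.2
  simp only [Finset.HasAntidiagonal.sigmaAntidiagonalEquivProd_apply]
  rw [← hi]
  push_cast
  congr 2 <;> ring

/-- the Chapman–Kolmogorov (semigroup) identity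
`∫ 𝒞^k Γ̄(t,x;s,ξ) 𝒞^N Γ̄(s,ξ;T,y) dξ = 𝒞^{k+N} Γ̄(t,x;T,y)`. -/
theorem stmt11 (M : ℝ) (hM : 0 < M) :
    ∀ (k N : ℕ) (t s T x y : ℝ), t < s → s < T →
      ∫ ξ : ℝ, ((Cop M)^[k] (fun x' => Gbar M t s x' ξ) x) *
          ((Cop M)^[N] (fun ξ' => Gbar M s T ξ' y) ξ) =
        (Cop M)^[k + N] (fun x' => Gbar M t T x' y) x := by
  intro k N t s T x y hts hsT
  have h1 : ∀ ξ, (Cop M)^[k] (fun x' => Gbar M t s x' ξ) x = Hk M k (s - t) (x - ξ) := fun ξ => by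
    rw [Cop_iter M hM k t s ξ hts]
  simp_rw [h1, Cop_iter M hM N s T y hsT, Cop_iter M hM (k + N) t T y (hts.trans hsT)]
  rw [Hk_semigroup M hM k N _ _ x y (by linarith) (by linarith)]
  congr 1
  ring
end

section
/- Fix M̄ > 0 and y ∈ ℝ, and for t < T and x ∈ ℝ define u(t,x) := Γ̄(t,x;T,y) := e^{−M̄(T−t)} Σ_{n=0}^∞ (M̄(T−t))^n / ( n! √(2π M̄ (T−t+n)) ) · exp( −(x − y + M̄ n)² / (2 M̄ (T−t+n)) ). Then for every t < T and x ∈ ℝ, u is differentiable in t, twice differentiable in x, the integral below converges absolutely, and u satisfies the backward partial integro-differential equation ∂_t u(t,x) + (M̄/2) ∂_x² u(t,x) + M̄ ∫_ℝ ( u(t, x+z) − u(t,x) ) 𝒩_{M̄,M̄}(dz) = 0, where 𝒩_{M̄,M̄} is the Gaussian measure on ℝ with mean M̄ and variance M̄. -/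
open MeasureTheory ProbabilityTheory Real

/-- Centered Gaussian density with variance `v`. -/
noncomputable def gph (v a : ℝ) : ℝ := (Real.sqrt (2 * Real.pi * v))⁻¹ * Real.exp (-a ^ 2 / (2 * v))

/-- A uniform bound for `gph v` over `v ≥ v0`. -/
noncomputable def gK (v : ℝ) : ℝ := (Real.sqrt (2 * Real.pi * v))⁻¹

lemma gK_pos {v : ℝ} (hv : 0 < v) : 0 < gK v := by unfold gK; positivity

lemma gph_nonneg (v a : ℝ) : 0 ≤ gph v a := by unfold gph; positivity

lemma gph_le {v0 v : ℝ} (h0 : 0 < v0) (hv : v0 ≤ v) (a : ℝ) : gph v a ≤ gK v0 := by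
  have hvp : 0 < v := h0.trans_le hv
  have h1 : Real.exp (-a ^ 2 / (2 * v)) ≤ 1 := by
    apply Real.exp_le_one_iff.2
    apply div_nonpos_of_nonpos_of_nonneg
    · nlinarith [sq_nonneg a]
    · positivity
  have h2 : (Real.sqrt (2 * Real.pi * v))⁻¹ ≤ (Real.sqrt (2 * Real.pi * v0))⁻¹ := by
    gcongr
  unfold gph gK
  calc _ ≤ (Real.sqrt (2 * Real.pi * v))⁻¹ * 1 := by gcongr
    _ ≤ _ := by simpa using h2

lemma gph_sq_le {v0 v : ℝ} (h0 : 0 < v0) (hv : v0 ≤ v) (a : ℝ) :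
    a ^ 2 / v ^ 2 * gph v a ≤ 2 / v0 * gK v0 := by
  have hvp : 0 < v := h0.trans_le hv
  have h1 : a ^ 2 / (2 * v) * Real.exp (-a ^ 2 / (2 * v)) ≤ 1 := by
    have := Real.add_one_le_exp (a ^ 2 / (2 * v))
    rw [neg_div, Real.exp_neg, ← div_eq_mul_inv, div_le_one (Real.exp_pos _)]
    linarith
  have h2 : gK v ≤ gK v0 := by unfold gK; gcongr
  have h3 := gK_pos hvp
  have e : a ^ 2 / v ^ 2 * gph v a
      = 2 / v * gK v * (a ^ 2 / (2 * v) * Real.exp (-a ^ 2 / (2 * v))) := by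
    unfold gph gK; field_simp
  rw [e]
  calc _ ≤ 2 / v * gK v * 1 := by gcongr
    _ ≤ _ := by rw [mul_one]; gcongr

/-- first space derivative -/
noncomputable def gph1 (v a : ℝ) : ℝ := -(a / v) * gph v a

/-- second space derivative -/
noncomputable def gph2 (v a : ℝ) : ℝ := (a ^ 2 / v ^ 2 - 1 / v) * gph v a

lemma gph1_le {v0 v : ℝ} (h0 : 0 < v0) (hv : v0 ≤ v) (a : ℝ) :
    |gph1 v a| ≤ (1 + 2 / v0) * gK v0 := by
  have h1 := gph_le h0 hv a
  have h2 := gph_sq_le h0 hv a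
  have h3 := gph_nonneg v a
  have h4 : |a / v| ≤ 1 + a ^ 2 / v ^ 2 := by
    rw [← div_pow, abs_le]
    constructor <;> nlinarith [sq_nonneg (a / v + 1), sq_nonneg (a / v - 1)]
  unfold gph1
  rw [abs_mul, abs_neg, abs_of_nonneg h3]
  calc _ ≤ (1 + a ^ 2 / v ^ 2) * gph v a := by gcongr
    _ ≤ _ := by linarith

lemma gph2_le {v0 v : ℝ} (h0 : 0 < v0) (hv : v0 ≤ v) (a : ℝ) :
    |gph2 v a| ≤ 3 / v0 * gK v0 := by
  have hvp : 0 < v := h0.trans_le hv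
  have h1 := gph_le h0 hv a
  have h2 := gph_sq_le h0 hv a
  have h3 := gph_nonneg v a
  have h4 : 1 / v * gph v a ≤ 1 / v0 * gK v0 := by gcongr
  have h5 : 0 ≤ 1 / v * gph v a := by positivity
  have h6 : 0 ≤ a ^ 2 / v ^ 2 * gph v a := by positivity
  have e : 3 / v0 * gK v0 = 2 / v0 * gK v0 + 1 / v0 * gK v0 := by ring
  unfold gph2
  rw [sub_mul, e, abs_le]
  constructor <;> linarith

lemma hasDerivAt_gph {v : ℝ} (hv : 0 < v) (a : ℝ) : HasDerivAt (gph v) (gph1 v a) a := by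
  have h := (((((hasDerivAt_id a).pow 2).neg).div_const (2 * v)).exp).const_mul
    ((Real.sqrt (2 * Real.pi * v))⁻¹)
  refine h.congr_deriv ?_
  simp [gph1, gph]
  field_simp

lemma hasDerivAt_gph1 {v : ℝ} (hv : 0 < v) (a : ℝ) : HasDerivAt (gph1 v) (gph2 v a) a := by
  have h := (((hasDerivAt_id a).div_const v).neg).mul (hasDerivAt_gph hv a)
  refine h.congr_deriv ?_
  simp [gph1, gph2]
  field_simp
  ring

lemma hasDerivAt_gph_var {v : ℝ} (hv : 0 < v) (a : ℝ) :
    HasDerivAt (fun v => gph v a) (1 / 2 * gph2 v a) v := by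
  have hs : 0 < Real.sqrt (2 * Real.pi * v) := by positivity
  have hq : Real.sqrt (2 * Real.pi * v) ^ 2 = 2 * Real.pi * v := Real.sq_sqrt (by positivity)
  have h1 := ((((hasDerivAt_id v).const_mul (2 * Real.pi)).sqrt (by simp; positivity)).inv
    (by simpa using hs.ne'))
  have h2 := ((hasDerivAt_const v (-a ^ 2)).div ((hasDerivAt_id v).const_mul 2)
    (by simpa using hv.ne')).exp
  refine (h1.mul h2).congr_deriv ?_
  simp only [gph2, gph, id, Pi.inv_apply, Pi.div_apply]
  simp only [hq]
  field_simp
  ring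

lemma gph_add_mul_pdf {M v : ℝ} (hM : 0 < M) (hv : 0 < v) (a z : ℝ) :
    gaussianPDFReal M M.toNNReal z * gph v (a + z)
      = gph (v + M) (a + M) *
        gaussianPDFReal (M * (v - a) / (v + M)) (v * M / (v + M)).toNNReal z := by
  have hw : 0 < v * M / (v + M) := by positivity
  simp only [gaussianPDFReal, gph, Real.coe_toNNReal _ hM.le, Real.coe_toNNReal _ hw.le]
  have e1 : (Real.sqrt (2 * Real.pi * M))⁻¹ * (Real.sqrt (2 * Real.pi * v))⁻¹
      = (Real.sqrt (2 * Real.pi * (v + M)))⁻¹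
        * (Real.sqrt (2 * Real.pi * (v * M / (v + M))))⁻¹ := by
    rw [← mul_inv, ← mul_inv, ← Real.sqrt_mul (by positivity), ← Real.sqrt_mul (by positivity)]
    congr 2
    field_simp
  have e2 : Real.exp (-(z - M) ^ 2 / (2 * M)) * Real.exp (-(a + z) ^ 2 / (2 * v))
      = Real.exp (-(a + M) ^ 2 / (2 * (v + M)))
        * Real.exp (-(z - M * (v - a) / (v + M)) ^ 2 / (2 * (v * M / (v + M)))) := by
    rw [← Real.exp_add, ← Real.exp_add]
    congr 1
    field_simp
    ring
  calc _ = ((Real.sqrt (2 * Real.pi * M))⁻¹ * (Real.sqrt (2 * Real.pi * v))⁻¹) *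
        (Real.exp (-(z - M) ^ 2 / (2 * M)) * Real.exp (-(a + z) ^ 2 / (2 * v))) := by ring
    _ = _ := by rw [e1, e2]; ring

lemma integral_gph {M v : ℝ} (hM : 0 < M) (hv : 0 < v) (a : ℝ) :
    ∫ z, gph v (a + z) ∂(gaussianReal M M.toNNReal) = gph (v + M) (a + M) := by
  have hw : 0 < v * M / (v + M) := by positivity
  rw [integral_gaussianReal_eq_integral_smul (by simpa using hM)]
  simp only [smul_eq_mul, gph_add_mul_pdf hM hv]
  rw [integral_const_mul, integral_gaussianPDFReal_eq_one _ (by simpa using hw), mul_one]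

lemma continuous_gph (v : ℝ) : Continuous (gph v) := by unfold gph; fun_prop

lemma integrable_gph {M v : ℝ} (hv : 0 < v) (a : ℝ) :
    Integrable (fun z => gph v (a + z)) (gaussianReal M M.toNNReal) := by
  refine Integrable.of_bound (C := gK v) ?_ ?_
  · exact ((continuous_gph v).comp (by fun_prop)).aestronglyMeasurable
  · refine Filter.Eventually.of_forall fun z => ?_
    rw [Real.norm_of_nonneg (gph_nonneg _ _)]
    exact gph_le hv le_rfl _

section series
variable {c d v : ℕ → ℝ} {v0 : ℝ}

lemma summable_gph (h0 : 0 < v0) (hv : ∀ n, v0 ≤ v n) (hc : Summable c) (hc0 : ∀ n, 0 ≤ c n) :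
    Summable fun n => c n * gph (v n) (d n) := by
  refine Summable.of_norm_bounded (hc.mul_right (gK v0)) fun n => ?_
  rw [norm_mul, Real.norm_of_nonneg (hc0 n), Real.norm_of_nonneg (gph_nonneg _ _)]
  exact mul_le_mul_of_nonneg_left (gph_le h0 (hv n) _) (hc0 n)

lemma hasDerivAt_series (h0 : 0 < v0) (hv : ∀ n, v0 ≤ v n) (hc : Summable c)
    (hc0 : ∀ n, 0 ≤ c n) (x : ℝ) :
    HasDerivAt (fun x => ∑' n, c n * gph (v n) (x + d n))
      (∑' n, c n * gph1 (v n) (x + d n)) x := by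
  refine hasDerivAt_tsum (u := fun n => c n * ((1 + 2 / v0) * gK v0)) (y₀ := 0)
    (g' := fun n x => c n * gph1 (v n) (x + d n)) (hc.mul_right _) ?_ ?_ ?_ x
  · intro n y
    exact ((hasDerivAt_gph (h0.trans_le (hv n)) (y + d n)).comp_add_const y (d n)).const_mul _
  · intro n y
    rw [norm_mul, Real.norm_of_nonneg (hc0 n)]
    exact mul_le_mul_of_nonneg_left (gph1_le h0 (hv n) _) (hc0 n)
  · exact summable_gph h0 hv hc hc0

lemma hasDerivAt_series1 (h0 : 0 < v0) (hv : ∀ n, v0 ≤ v n) (hc : Summable c)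
    (hc0 : ∀ n, 0 ≤ c n) (x : ℝ) :
    HasDerivAt (fun x => ∑' n, c n * gph1 (v n) (x + d n))
      (∑' n, c n * gph2 (v n) (x + d n)) x := by
  refine hasDerivAt_tsum (u := fun n => c n * (3 / v0 * gK v0)) (y₀ := 0)
    (g' := fun n x => c n * gph2 (v n) (x + d n)) (hc.mul_right _) ?_ ?_ ?_ x
  · intro n y
    exact ((hasDerivAt_gph1 (h0.trans_le (hv n)) (y + d n)).comp_add_const y (d n)).const_mul _
  · intro n y
    rw [norm_mul, Real.norm_of_nonneg (hc0 n)]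
    exact mul_le_mul_of_nonneg_left (gph2_le h0 (hv n) _) (hc0 n)
  · refine Summable.of_norm_bounded (hc.mul_right ((1 + 2 / v0) * gK v0)) fun n => ?_
    rw [norm_mul, Real.norm_of_nonneg (hc0 n)]
    exact mul_le_mul_of_nonneg_left (gph1_le h0 (hv n) _) (hc0 n)

lemma integrable_series (h0 : 0 < v0) (hv : ∀ n, v0 ≤ v n) (hc : Summable c)
    (hc0 : ∀ n, 0 ≤ c n) (M x : ℝ) :
    Integrable (fun z => ∑' n, c n * gph (v n) (x + z + d n)) (gaussianReal M M.toNNReal) := by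
  refine Integrable.of_bound (C := ∑' n, c n * gK v0) ?_ ?_
  · have h : Continuous (fun x => ∑' n, c n * gph (v n) (x + d n)) :=
      continuous_iff_continuousAt.2 fun x => (hasDerivAt_series h0 hv hc hc0 x).continuousAt
    exact (h.comp (continuous_const_add x)).aestronglyMeasurable
  · refine Filter.Eventually.of_forall fun z => ?_
    refine tsum_of_norm_bounded (hc.mul_right _).hasSum fun n => ?_
    rw [norm_mul, Real.norm_of_nonneg (hc0 n), Real.norm_of_nonneg (gph_nonneg _ _)]
    exact mul_le_mul_of_nonneg_left (gph_le h0 (hv n) _) (hc0 n)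

lemma integral_series (h0 : 0 < v0) (hv : ∀ n, v0 ≤ v n) (hc : Summable c)
    (hc0 : ∀ n, 0 ≤ c n) {M : ℝ} (hM : 0 < M) (x : ℝ) :
    ∫ z, ∑' n, c n * gph (v n) (x + z + d n) ∂(gaussianReal M M.toNNReal)
      = ∑' n, c n * gph (v n + M) (x + d n + M) := by
  have e : ∀ n z, c n * gph (v n) (x + z + d n) = c n * gph (v n) ((x + d n) + z) := by
    intro n z; congr 2; ring
  simp only [e]
  have hi : ∀ n, ∫ z, c n * gph (v n) ((x + d n) + z) ∂(gaussianReal M M.toNNReal)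
      = c n * gph (v n + M) (x + d n + M) := by
    intro n
    rw [integral_const_mul, integral_gph hM (h0.trans_le (hv n))]
  have hn : ∀ n z, ‖c n * gph (v n) ((x + d n) + z)‖ = c n * gph (v n) ((x + d n) + z) :=
    fun n z => Real.norm_of_nonneg (mul_nonneg (hc0 n) (gph_nonneg _ _))
  rw [← integral_tsum_of_summable_integral_norm]
  · simp only [hi]
  · exact fun n => (integrable_gph (h0.trans_le (hv n)) _).const_mul _
  · simp only [hn, hi]
    exact summable_gph h0 (fun n => (hv n).trans (by linarith)) hc hc0

end series

lemma summable_pois (R : ℝ) : Summable fun n : ℕ => R ^ n / (n.factorial : ℝ) :=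
  Real.summable_pow_div_factorial R

lemma pois_succ (R : ℝ) (n : ℕ) :
    ((n + 1 : ℕ) : ℝ) * R ^ (n + 1 - 1) / ((n + 1).factorial : ℝ) = R ^ n / (n.factorial : ℝ) := by
  rw [Nat.factorial_succ]
  push_cast
  have : ((n : ℝ) + 1) ≠ 0 := by positivity
  have : (n.factorial : ℝ) ≠ 0 := by positivity
  field_simp

lemma summable_pois' (R : ℝ) : Summable fun n : ℕ => (n : ℝ) * R ^ (n - 1) / (n.factorial : ℝ) := by
  rw [← summable_nat_add_iff 1]
  simp only [pois_succ]
  exact summable_pois R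

lemma hasDerivAt_time {M : ℝ} (hM : 0 < M) (b : ℕ → ℝ) {s : ℝ} (hs : 0 < s) :
    HasDerivAt (fun s => ∑' n : ℕ, (M * s) ^ n / (n.factorial : ℝ) * gph (M * (s + n)) (b n))
      (M * (∑' n : ℕ, (M * s) ^ n / (n.factorial : ℝ) * gph (M * (s + (n + 1 : ℕ))) (b (n + 1)))
        + M / 2 * ∑' n : ℕ, (M * s) ^ n / (n.factorial : ℝ) * gph2 (M * (s + n)) (b n)) s := by
  set R := M * (2 * s) with hR
  have hR0 : 0 < R := by positivity
  set v0 := M * (s / 2) with hv0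
  have h0 : 0 < v0 := by positivity
  have hvv : ∀ (n : ℕ) (r : ℝ), s / 2 < r → v0 ≤ M * (r + n) := by
    intro n r hr
    have : (0 : ℝ) ≤ n := Nat.cast_nonneg n
    rw [hv0]; gcongr; linarith
  have key := hasDerivAt_tsum_of_isPreconnected (t := Set.Ioo (s / 2) (2 * s)) (y := s) (y₀ := s)
    (g := fun (n : ℕ) s => (M * s) ^ n / (n.factorial : ℝ) * gph (M * (s + n)) (b n))
    (g' := fun (n : ℕ) s => M * ((n : ℝ) * (M * s) ^ (n - 1) / (n.factorial : ℝ)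
        * gph (M * (s + n)) (b n))
        + M / 2 * ((M * s) ^ n / (n.factorial : ℝ) * gph2 (M * (s + n)) (b n)))
    (u := fun n : ℕ => M * ((n : ℝ) * R ^ (n - 1) / (n.factorial : ℝ) * gK v0)
        + M / 2 * (R ^ n / (n.factorial : ℝ) * (3 / v0 * gK v0)))
    ((((summable_pois' R).mul_right _).mul_left _).add
      (((summable_pois R).mul_right _).mul_left _)) isOpen_Ioo isPreconnected_Ioo
    ?_ ?_ ⟨by linarith, by linarith⟩ ?_ ⟨by linarith, by linarith⟩
  · refine key.congr_deriv ?_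
    have hc0 : ∀ n : ℕ, 0 ≤ (M * s) ^ n / (n.factorial : ℝ) := fun n => by positivity
    have hsA : Summable fun n : ℕ => (n : ℝ) * (M * s) ^ (n - 1) / (n.factorial : ℝ)
        * gph (M * (s + n)) (b n) :=
      summable_gph h0 (fun n => hvv n s (by linarith)) (summable_pois' (M * s))
        (fun n => by positivity)
    have hsB : Summable fun n : ℕ => (M * s) ^ n / (n.factorial : ℝ) * gph2 (M * (s + n)) (b n) := by
      refine Summable.of_norm_bounded ((summable_pois (M * s)).mul_right (3 / v0 * gK v0))
        fun n => ?_
      rw [norm_mul, Real.norm_of_nonneg (hc0 n)]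
      exact mul_le_mul_of_nonneg_left (gph2_le h0 (hvv n s (by linarith)) _) (hc0 n)
    rw [(hsA.mul_left M).tsum_add (hsB.mul_left (M / 2)), tsum_mul_left, tsum_mul_left]
    congr 2
    rw [hsA.tsum_eq_zero_add]
    simp only [pois_succ]
    simp
  · rintro n r ⟨h1, h2⟩
    have hr : 0 < r := by linarith
    have hA : HasDerivAt (fun r => (M * r) ^ n / (n.factorial : ℝ))
        (M * ((n : ℝ) * (M * r) ^ (n - 1) / (n.factorial : ℝ))) r := by
      refine ((((hasDerivAt_id r).const_mul M).pow n).div_const _).congr_deriv ?_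
      simp; ring
    have hB : HasDerivAt (fun r => gph (M * (r + n)) (b n))
        (1 / 2 * gph2 (M * (r + n)) (b n) * (M * 1)) r :=
      (hasDerivAt_gph_var (by positivity) (b n)).comp r
        (((hasDerivAt_id r).add_const (n : ℝ)).const_mul M)
    exact (hA.mul hB).congr_deriv (by ring)
  · rintro n r ⟨h1, h2⟩
    have hr : 0 < r := by linarith
    have hrR : M * r ≤ R := by rw [hR]; gcongr
    have g1 := gph_le h0 (hvv n r h1) (b n)
    have g2 := gph2_le h0 (hvv n r h1) (b n)
    have g0 := gph_nonneg (M * (r + n)) (b n)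
    have k0 := gK_pos h0
    refine (norm_add_le _ _).trans (add_le_add ?_ ?_)
    · rw [Real.norm_of_nonneg (by positivity)]
      gcongr
    · rw [norm_mul, norm_mul, Real.norm_of_nonneg (by positivity : 0 ≤ M / 2),
        Real.norm_of_nonneg (by positivity : 0 ≤ (M * r) ^ n / (n.factorial : ℝ)), Real.norm_eq_abs]
      gcongr
  · exact summable_gph h0 (fun n => hvv n s (by linarith)) (summable_pois (M * s))
        (fun n => by positivity)

lemma Gbar_eq_s12 (M t T x y : ℝ) : Gbar M t T x y = Real.exp (-(M * (T - t))) *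
    ∑' n : ℕ, (M * (T - t)) ^ n / (n.factorial : ℝ) *
      gph (M * (T - t + n)) (x + (-y + M * n)) := by
  unfold Gbar gph
  congr 1
  refine tsum_congr fun n => ?_
  rw [show x + (-y + M * n) = x - y + M * n by ring, ← mul_assoc, div_mul_eq_div_div,
    ← mul_assoc (2 * Real.pi), ← mul_assoc 2 M]
  simp only [div_eq_mul_inv]

/-- `u(t,x) := Γ̄(t,x;T,y)` is differentiable in `t`, twice differentiable
in `x`, the jump integral converges absolutely, and `u` solves the backward PIDE
`∂_t u + (M̄/2) ∂_x² u + M̄ ∫ (u(t,x+z) − u(t,x)) 𝒩_{M̄,M̄}(dz) = 0`. -/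
theorem stmt12 (M : ℝ) (hM : 0 < M) (T y : ℝ) :
    ∀ t < T, ∀ x : ℝ,
      DifferentiableAt ℝ (fun t' => Gbar M t' T x y) t ∧
      DifferentiableAt ℝ (fun x' => Gbar M t T x' y) x ∧
      DifferentiableAt ℝ (deriv (fun x' => Gbar M t T x' y)) x ∧
      Integrable (fun z => Gbar M t T (x + z) y - Gbar M t T x y)
        (gaussianReal M M.toNNReal) ∧
      deriv (fun t' => Gbar M t' T x y) t
          + (M / 2) * deriv (deriv (fun x' => Gbar M t T x' y)) x
          + M * ∫ z, (Gbar M t T (x + z) y - Gbar M t T x y)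
              ∂(gaussianReal M M.toNNReal) = 0 := by
  intro t ht x
  have hs : 0 < T - t := sub_pos.2 ht
  have h0 : 0 < M * (T - t) := by positivity
  have hv : ∀ n : ℕ, M * (T - t) ≤ M * (T - t + n) := by
    intro n
    have : (0 : ℝ) ≤ n := Nat.cast_nonneg n
    gcongr; linarith
  have hc := summable_pois (M * (T - t))
  have hc0 : ∀ n : ℕ, 0 ≤ (M * (T - t)) ^ n / (n.factorial : ℝ) := fun n => by positivity
  have hx1 : ∀ x, HasDerivAt (fun x' => Gbar M t T x' y) (Real.exp (-(M * (T - t))) *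
      ∑' n : ℕ, (M * (T - t)) ^ n / (n.factorial : ℝ) *
        gph1 (M * (T - t + n)) (x + (-y + M * n))) x := by
    intro x
    simp only [Gbar_eq_s12]
    exact (hasDerivAt_series h0 hv hc hc0 x).const_mul _
  have hd : deriv (fun x' => Gbar M t T x' y) = fun x => Real.exp (-(M * (T - t))) *
      ∑' n : ℕ, (M * (T - t)) ^ n / (n.factorial : ℝ) *
        gph1 (M * (T - t + n)) (x + (-y + M * n)) := funext fun x => (hx1 x).deriv
  have hx2 : HasDerivAt (deriv (fun x' => Gbar M t T x' y)) (Real.exp (-(M * (T - t))) *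
      ∑' n : ℕ, (M * (T - t)) ^ n / (n.factorial : ℝ) *
        gph2 (M * (T - t + n)) (x + (-y + M * n))) x := by
    rw [hd]
    exact (hasDerivAt_series1 h0 hv hc hc0 x).const_mul _
  have hint : Integrable (fun z => Gbar M t T (x + z) y) (gaussianReal M M.toNNReal) := by
    simp only [Gbar_eq_s12]
    exact (integrable_series h0 hv hc hc0 M x).const_mul _
  have hval : ∫ z, Gbar M t T (x + z) y ∂(gaussianReal M M.toNNReal)
      = Real.exp (-(M * (T - t))) * ∑' n : ℕ, (M * (T - t)) ^ n / (n.factorial : ℝ) *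
        gph (M * (T - t + (n + 1 : ℕ))) (x + (-y + M * (n + 1 : ℕ))) := by
    simp only [Gbar_eq_s12]
    rw [integral_const_mul, integral_series h0 hv hc hc0 hM x]
    congr 1
    refine tsum_congr fun n => ?_
    congr 2 <;> push_cast <;> ring
  have hsub : HasDerivAt (fun t' => T - t') (-1) t := by
    simpa using (hasDerivAt_id t).const_sub T
  have htime := (hasDerivAt_time hM (fun n : ℕ => x + (-y + M * n)) hs).comp t hsub
  have ht1 := ((hsub.const_mul M).neg.exp).mul htime
  have hfun : (fun t' => Gbar M t' T x y) = _ := funext fun t' => Gbar_eq_s12 M t' T x y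
  have ht2 := ht1.congr_of_eventuallyEq (Filter.EventuallyEq.of_eq hfun)
  refine ⟨ht2.differentiableAt, (hx1 x).differentiableAt, hx2.differentiableAt,
    hint.sub (integrable_const _), ?_⟩
  rw [ht2.deriv, hx2.deriv, integral_sub hint (integrable_const _), hval]
  simp only [integral_const, probReal_univ, one_smul, Gbar_eq_s12, Function.comp, Pi.neg_apply]
  ring
end

section
/- Fix M̄ > 0 and let Γ̄(t,x;T,y) := e^{−M̄(T−t)} Σ_{n=0}^∞ (M̄(T−t))^n / ( n! √(2π M̄ (T−t+n)) ) · exp( −(x − y + M̄ n)² / (2 M̄ (T−t+n)) ) for t < T. Then for any fixed x ≠ y, lim_{t → T⁻} Γ̄(t,x;T,y) / (T−t) = √( M̄/(2π) ) · exp( −(x − y + M̄)² / (2 M̄) ). In particular, for x ≠ y, Γ̄(t,x;T,y) = O(T−t) as t → T⁻. -/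
open MeasureTheory Real Filter Asymptotics

/-- The `n`-th term of the series, divided by `s = T - t`. -/
noncomputable def auxF (M d : ℝ) (s : ℝ) (n : ℕ) : ℝ :=
  (M * s) ^ n / ((n.factorial : ℝ) * Real.sqrt (2 * Real.pi * M * (s + n))) *
      Real.exp (-(d + M * n) ^ 2 / (2 * M * (s + n))) / s

lemma auxF_zero (M d : ℝ) (hM : 0 < M) (hd : d ≠ 0) :
    Tendsto (fun s => auxF M d s 0) (nhdsWithin 0 (Set.Ioi 0)) (nhds 0) := by
  have hc : 0 < d ^ 2 / (2 * M) := by positivity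
  have h1 := (tendsto_rpow_mul_exp_neg_mul_atTop_nhds_zero (3/2) _ hc).comp
    (tendsto_inv_nhdsGT_zero (𝕜 := ℝ))
  have h2 := h1.const_mul (Real.sqrt (2 * Real.pi * M))⁻¹
  rw [mul_zero] at h2
  refine h2.congr' ?_
  filter_upwards [self_mem_nhdsWithin] with s hs
  have hs : 0 < s := hs
  have h3 : (s⁻¹) ^ (3/2 : ℝ) = s⁻¹ * (Real.sqrt s)⁻¹ := by
    rw [show (3/2 : ℝ) = 1 + 1/2 by norm_num, Real.rpow_add (by positivity), Real.rpow_one,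
      ← Real.sqrt_eq_rpow, Real.sqrt_inv]
  have h4 : -(d ^ 2 / (2 * M)) * s⁻¹ = -d ^ 2 / (2 * M * s) := by
    field_simp
  have h5 : Real.sqrt (2 * Real.pi * M * s) = Real.sqrt (2 * Real.pi * M) * Real.sqrt s :=
    Real.sqrt_mul (by positivity) s
  simp only [Function.comp, auxF, h3, h4]
  simp only [pow_zero, Nat.factorial_zero, Nat.cast_one, Nat.cast_zero, add_zero, mul_zero,
    one_mul, h5]
  field_simp

lemma auxF_succ_eq (M d s : ℝ) (hs : 0 < s) (m : ℕ) : auxF M d s (m + 1) =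
    M ^ (m + 1) * s ^ m / (((m + 1).factorial : ℝ) *
      Real.sqrt (2 * Real.pi * M * (s + (m + 1 : ℕ)))) *
      Real.exp (-(d + M * (m + 1 : ℕ)) ^ 2 / (2 * M * (s + (m + 1 : ℕ)))) := by
  unfold auxF
  rw [mul_pow, pow_succ s m, div_eq_iff hs.ne']
  ring

lemma auxF_succ (M d : ℝ) (hM : 0 < M) (m : ℕ) :
    Tendsto (fun s => auxF M d s (m + 1)) (nhdsWithin 0 (Set.Ioi 0))
      (nhds (M ^ (m + 1) * 0 ^ m / (((m + 1).factorial : ℝ) *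
      Real.sqrt (2 * Real.pi * M * (0 + (m + 1 : ℕ)))) *
      Real.exp (-(d + M * (m + 1 : ℕ)) ^ 2 / (2 * M * (0 + (m + 1 : ℕ)))))) := by
  have hc : ContinuousAt (fun s : ℝ => M ^ (m + 1) * s ^ m / (((m + 1).factorial : ℝ) *
      Real.sqrt (2 * Real.pi * M * (s + (m + 1 : ℕ)))) *
      Real.exp (-(d + M * (m + 1 : ℕ)) ^ 2 / (2 * M * (s + (m + 1 : ℕ))))) 0 := by
    have h1 : ((m + 1).factorial : ℝ) *
      Real.sqrt (2 * Real.pi * M * (0 + (m + 1 : ℕ))) ≠ 0 := by positivity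
    have h2 : (2 * M * (0 + ((m + 1 : ℕ) : ℝ))) ≠ 0 := by positivity
    have h4 : ContinuousAt (fun s : ℝ => M ^ (m + 1) * s ^ m / (((m + 1).factorial : ℝ) *
        Real.sqrt (2 * Real.pi * M * (s + (m + 1 : ℕ))))) 0 :=
      ContinuousAt.div (by fun_prop) (by fun_prop) h1
    refine h4.mul ?_
    have h3 : ContinuousAt (fun s : ℝ =>
        -(d + M * (m + 1 : ℕ)) ^ 2 / (2 * M * (s + (m + 1 : ℕ)))) 0 :=
      ContinuousAt.div (by fun_prop) (by fun_prop) h2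
    exact h3.rexp
  refine (hc.tendsto.mono_left nhdsWithin_le_nhds).congr' ?_
  filter_upwards [self_mem_nhdsWithin] with s hs
  exact (auxF_succ_eq M d s hs m).symm

lemma auxF_tsum (M d : ℝ) (hM : 0 < M) (hd : d ≠ 0) :
    Tendsto (fun s => ∑' n, auxF M d s n) (nhdsWithin 0 (Set.Ioi 0))
      (nhds (Real.sqrt (M / (2 * Real.pi)) * Real.exp (-(d + M) ^ 2 / (2 * M)))) := by
  set L := Real.sqrt (M / (2 * Real.pi)) * Real.exp (-(d + M) ^ 2 / (2 * M)) with hL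
  have hpi := Real.pi_pos
  have hC : 0 < (Real.sqrt (2 * Real.pi * M))⁻¹ := by positivity
  have key := tendsto_tsum_of_dominated_convergence (𝓕 := nhdsWithin (0:ℝ) (Set.Ioi 0))
    (f := auxF M d) (g := fun n => if n = 1 then L else 0)
    (bound := fun n => M ^ n / (n.factorial : ℝ) * (Real.sqrt (2 * Real.pi * M))⁻¹)
    ((Real.summable_pow_div_factorial M).mul_right _) ?_ ?_
  · rwa [tsum_ite_eq] at key
  · intro n
    rcases n with _ | _ | m
    · simpa using auxF_zero M d hM hd
    · have h := auxF_succ M d hM 0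
      convert h using 2
      have : Real.sqrt (M / (2 * Real.pi)) = M / Real.sqrt (2 * Real.pi * M) := by
        rw [eq_div_iff (by positivity), ← Real.sqrt_mul (by positivity),
          show M / (2 * Real.pi) * (2 * Real.pi * M) = M ^ 2 by field_simp,
          Real.sqrt_sq hM.le]
      simp [hL, this]
    · have h := auxF_succ M d hM (m + 1)
      simpa using h
  · have h0 : ∀ᶠ s in nhdsWithin (0:ℝ) (Set.Ioi 0),
        ‖auxF M d s 0‖ ≤ (Real.sqrt (2 * Real.pi * M))⁻¹ := by
      have := (auxF_zero M d hM hd).norm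
      rw [norm_zero] at this
      exact (this.eventually_lt_const hC).mono fun _ h => h.le
    have h1 : ∀ᶠ s in nhdsWithin (0:ℝ) (Set.Ioi 0), s < 1 :=
      nhdsWithin_le_nhds (eventually_lt_nhds one_pos)
    filter_upwards [h0, h1, self_mem_nhdsWithin] with s h0 h1 hs n
    have hs : 0 < s := hs
    rcases n with _ | m
    · simpa using h0
    · rw [auxF_succ_eq M d s hs m, Real.norm_of_nonneg (by positivity)]
      have he : Real.exp (-(d + M * (m + 1 : ℕ)) ^ 2 / (2 * M * (s + (m + 1 : ℕ)))) ≤ 1 := by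
        rw [Real.exp_le_one_iff]
        exact div_nonpos_of_nonpos_of_nonneg (neg_nonpos.2 (sq_nonneg _)) (by positivity)
      have hp : s ^ m ≤ 1 := pow_le_one₀ hs.le h1.le
      have hq : Real.sqrt (2 * Real.pi * M) ≤
          Real.sqrt (2 * Real.pi * M * (s + (m + 1 : ℕ))) := by
        apply Real.sqrt_le_sqrt
        apply le_mul_of_one_le_right (by positivity)
        push_cast
        have : (0:ℝ) ≤ m := by positivity
        linarith
      calc _ ≤ M ^ (m + 1) * 1 / (((m + 1).factorial : ℝ) * Real.sqrt (2 * Real.pi * M)) * 1 := by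
            gcongr
        _ = _ := by
            field_simp

theorem stmt13 (M : ℝ) (hM : 0 < M) (T x y : ℝ) (hxy : x ≠ y) :
    Tendsto (fun t => Gbar M t T x y / (T - t)) (nhdsWithin T (Set.Iio T))
      (nhds (Real.sqrt (M / (2 * Real.pi)) * Real.exp (-(x - y + M) ^ 2 / (2 * M)))) ∧
    (fun t => Gbar M t T x y) =O[nhdsWithin T (Set.Iio T)] (fun t => T - t) := by
  have hs : Tendsto (fun t => T - t) (nhdsWithin T (Set.Iio T)) (nhdsWithin 0 (Set.Ioi 0)) := by
    refine tendsto_nhdsWithin_iff.2 ⟨?_, ?_⟩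
    · have : ContinuousAt (fun t => T - t) T := by fun_prop
      have h := this.tendsto
      rw [sub_self] at h
      exact h.mono_left nhdsWithin_le_nhds
    · filter_upwards [self_mem_nhdsWithin] with t ht
      exact sub_pos.2 (Set.mem_Iio.1 ht)
  have h1 : Tendsto (fun t => Gbar M t T x y / (T - t)) (nhdsWithin T (Set.Iio T))
      (nhds (Real.sqrt (M / (2 * Real.pi)) * Real.exp (-(x - y + M) ^ 2 / (2 * M)))) := by
    have he : Tendsto (fun s => Real.exp (-(M * s))) (nhdsWithin 0 (Set.Ioi 0)) (nhds 1) := by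
      have : ContinuousAt (fun s => Real.exp (-(M * s))) 0 := by fun_prop
      have h := this.tendsto
      simp only [mul_zero, neg_zero, Real.exp_zero] at h
      exact h.mono_left nhdsWithin_le_nhds
    have h := (he.mul (auxF_tsum M (x - y) hM (sub_ne_zero.2 hxy))).comp hs
    rw [one_mul] at h
    refine h.congr fun t => ?_
    simp only [Function.comp, Gbar, auxF, tsum_div_const]
    rw [mul_div_assoc]
  refine ⟨h1, ?_⟩
  refine isBigO_of_div_tendsto_nhds ?_ _ h1
  filter_upwards [self_mem_nhdsWithin] with t ht h
  exact absurd h (sub_pos.2 (Set.mem_Iio.1 ht)).ne'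
end

section
/- Fix M̄ > 0 and an integer k ≥ 1. For t < T and x, y ∈ ℝ define 𝒞^k Γ̄(t,x;T,y) := e^{−M̄(T−t)} Σ_{n=0}^∞ (M̄(T−t))^n / ( n! √(2π M̄ (T−t+n+k)) ) · exp( −(x − y + M̄(n+k))² / (2 M̄ (T−t+n+k)) ). Then for every x, y ∈ ℝ, lim_{t → T⁻} 𝒞^k Γ̄(t,x;T,y) = (1/√(2π M̄ k)) · exp( −(x − y + M̄ k)² / (2 M̄ k) ); in particular, for k ≥ 1 the function 𝒞^k Γ̄(t,x;T,y) tends to a strictly positive constant as T − t → 0, even when x ≠ y. -/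
open MeasureTheory Real Filter

/-- for `k ≥ 1`, the explicit series defining `𝒞^k Γ̄(t,x;T,y)` tends, as
`t → T⁻`, to the strictly positive constant
`(1/√(2π M̄ k)) exp(−(x−y+M̄k)²/(2M̄k))`, even when `x ≠ y`. -/
theorem stmt14 (M : ℝ) (hM : 0 < M) (k : ℕ) (hk : 1 ≤ k) (T x y : ℝ) :
    Tendsto
      (fun t => Real.exp (-(M * (T - t))) * ∑' n : ℕ,
        (M * (T - t)) ^ n /
            ((n.factorial : ℝ) * Real.sqrt (2 * Real.pi * M * (T - t + n + k))) *
          Real.exp (-(x - y + M * ((n : ℝ) + k)) ^ 2 / (2 * M * (T - t + n + k))))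
      (nhdsWithin T (Set.Iio T))
      (nhds ((1 / Real.sqrt (2 * Real.pi * M * k)) *
        Real.exp (-(x - y + M * k) ^ 2 / (2 * M * k)))) ∧
    0 < (1 / Real.sqrt (2 * Real.pi * M * k)) *
        Real.exp (-(x - y + M * k) ^ 2 / (2 * M * k)) := by
  have hk' : (1 : ℝ) ≤ k := by exact_mod_cast hk
  have hkpos : (0 : ℝ) < k := by linarith
  have hpi := Real.pi_pos
  refine ⟨?_, by positivity⟩
  set f : ℝ → ℕ → ℝ := fun t n => (M * (T - t)) ^ n /
            ((n.factorial : ℝ) * Real.sqrt (2 * Real.pi * M * (T - t + n + k))) *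
          Real.exp (-(x - y + M * ((n : ℝ) + k)) ^ 2 / (2 * M * (T - t + n + k))) with hf
  have hsum : ∑' n, f T n = (1 / Real.sqrt (2 * Real.pi * M * k)) *
        Real.exp (-(x - y + M * k) ^ 2 / (2 * M * k)) := by
    rw [tsum_eq_single 0]
    · simp [hf]
    · intro n hn
      simp [hf, hn]
  have hmain : Tendsto (fun t => ∑' n, f t n) (nhdsWithin T (Set.Iio T))
      (nhds (∑' n, f T n)) := by
    apply tendsto_tsum_of_dominated_convergence
      (bound := fun n : ℕ => M ^ n / (n.factorial : ℝ) * (1 / Real.sqrt (2 * Real.pi * M)))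
    · exact (Real.summable_pow_div_factorial M).mul_right _
    · intro n
      have h0 : T - T + (n : ℝ) + k ≠ 0 := by
        have : (0 : ℝ) < T - T + n + k := by rw [sub_self]; positivity
        exact this.ne'
      have hpos : 0 < T - T + (n : ℝ) + k := by rw [sub_self]; positivity
      have h1 : (n.factorial : ℝ) * Real.sqrt (2 * Real.pi * M * (T - T + n + k)) ≠ 0 := by
        have : (0 : ℝ) < n.factorial := by positivity
        positivity
      have h2 : 2 * M * (T - T + (n : ℝ) + k) ≠ 0 := by positivity
      have hc : ContinuousAt (fun t => f t n) T := by
        simp only [hf]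
        refine ContinuousAt.mul (ContinuousAt.div (by fun_prop) (by fun_prop) h1) ?_
        exact Real.continuous_exp.continuousAt.comp
          (ContinuousAt.div (by fun_prop) (by fun_prop) h2)
      exact hc.tendsto.mono_left nhdsWithin_le_nhds
    · have hI : Set.Ioo (T - 1) T ∈ nhdsWithin T (Set.Iio T) :=
        Ioo_mem_nhdsLT (by linarith)
      filter_upwards [hI] with t ht n
      obtain ⟨ht1, ht2⟩ := ht
      have hs : 0 < T - t := by linarith
      have hn0 : (0 : ℝ) ≤ n := by positivity
      have hge : 1 ≤ T - t + n + k := by linarith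
      have hfac : (0 : ℝ) < n.factorial := by positivity
      have hnn : 0 ≤ f t n := by simp only [hf]; positivity
      rw [Real.norm_of_nonneg hnn]
      have he : Real.exp (-(x - y + M * ((n : ℝ) + k)) ^ 2 / (2 * M * (T - t + n + k))) ≤ 1 := by
        rw [Real.exp_le_one_iff]
        apply div_nonpos_of_nonpos_of_nonneg
        · nlinarith [sq_nonneg (x - y + M * ((n : ℝ) + k))]
        · positivity
      have hsq : Real.sqrt (2 * Real.pi * M) ≤
          Real.sqrt (2 * Real.pi * M * (T - t + n + k)) := by
        apply Real.sqrt_le_sqrt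
        exact le_mul_of_one_le_right (by positivity) hge
      have hp : (M * (T - t)) ^ n ≤ M ^ n := by
        apply pow_le_pow_left₀ (by positivity)
        exact mul_le_of_le_one_right hM.le (by linarith)
      calc f t n ≤ (M * (T - t)) ^ n /
            ((n.factorial : ℝ) * Real.sqrt (2 * Real.pi * M * (T - t + n + k))) :=
            mul_le_of_le_one_right (by positivity) he
        _ ≤ M ^ n / ((n.factorial : ℝ) * Real.sqrt (2 * Real.pi * M)) := by
            gcongr
        _ = _ := by rw [div_mul_div_comm, mul_one]
  have hexp : Tendsto (fun t => Real.exp (-(M * (T - t)))) (nhdsWithin T (Set.Iio T))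
      (nhds 1) := by
    have hc : Continuous (fun t => Real.exp (-(M * (T - t)))) := by fun_prop
    have := (hc.tendsto T).mono_left (nhdsWithin_le_nhds (s := Set.Iio T))
    simpa using this
  have := hexp.mul hmain
  rw [hsum, one_mul] at this
  exact this
end
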